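/- Let a_n denote the number of permutations of length n avoiding both 4321 and 3142, with a_0 = 1. Then, as formal power series over the integers, (1 − 8x + 21x² − 20x³ + 4x⁴) · ∑_{n≥0} a_n xⁿ = 1 − 7x + 15x² − 9x³; equivalently, ∑_{n≥0} a_n xⁿ = (1−x)(1−3x)²/((1−2x)²(1−4x+x²)). -/

import Mathlib

/-- A list of naturals is a permutation (in one-line notation) of `1,…,n`
where `n` is its length. -/
def IsPermList (l : List ℕ) : Prop :=
  l.Perm ((List.range l.length).map (· + 1))

/-- `f` is an occurrence of the pattern `β` in `π`: a strictly increasing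
choice of indices of `π` whose entries are order isomorphic to `β`. -/
def IsOccurrence (π β : List ℕ) (f : Fin β.length → Fin π.length) : Prop :=
  StrictMono f ∧ ∀ s t : Fin β.length, π.get (f s) < π.get (f t) ↔ β.get s < β.get t

/-- `π` contains the pattern `β`. -/
def PContains (π β : List ℕ) : Prop :=
  ∃ f : Fin β.length → Fin π.length, IsOccurrence π β f

/-- `π` avoids the pattern `β`. -/
def PAvoids (π β : List ℕ) : Prop :=
  ¬ PContains π β

/-- The class of permutations avoiding every member of `B`. -/
def Av (B : Set (List ℕ)) : Set (List ℕ) :=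
  {π | IsPermList π ∧ ∀ β ∈ B, PAvoids π β}

/-- Insert a new maximum entry at (0-indexed) position `i` of `l`. -/
def insertMax (l : List ℕ) (i : ℕ) : List ℕ :=
  l.insertIdx i (l.length + 1)

/-- Position `i` is an active site of `l` relative to `B`. -/
def ActiveSite (B : Set (List ℕ)) (l : List ℕ) (i : ℕ) : Prop :=
  i ≤ l.length ∧ insertMax l i ∈ Av B

/-- The increasing permutation `1,2,…,n`. -/
def incrPerm (n : ℕ) : List ℕ :=
  (List.range n).map (· + 1)

/-- A permutation (as a list) is a vertical alternation: every entry in an even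
(1-indexed) position lies above every entry in an odd position, or vice versa.
(Index `s : Fin l.length` corresponds to 1-indexed position `s + 1`.) -/
def VerticalAlternation (l : List ℕ) : Prop :=
  (∀ s t : Fin l.length, s.val % 2 = 1 → t.val % 2 = 0 → l.get t < l.get s) ∨
  (∀ s t : Fin l.length, s.val % 2 = 1 → t.val % 2 = 0 → l.get s < l.get t)

/-- The subsequence of entries in positions congruent to `r` (0-indexed, mod 2)
is increasing. -/
def IncOnRes (l : List ℕ) (r : ℕ) : Prop :=
  ∀ s t : Fin l.length, s < t → s.val % 2 = r → t.val % 2 = r → l.get s < l.get t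

/-- The subsequence of entries in positions congruent to `r` (0-indexed, mod 2)
is decreasing. -/
def DecOnRes (l : List ℕ) (r : ℕ) : Prop :=
  ∀ s t : Fin l.length, s < t → s.val % 2 = r → t.val % 2 = r → l.get t < l.get s

/-- A vertical parallel alternation: a vertical alternation of even length whose
odd-position and even-position subsequences are both increasing or both decreasing. -/
def IsVertParallel (l : List ℕ) : Prop :=
  VerticalAlternation l ∧ Even l.length ∧
    ((IncOnRes l 0 ∧ IncOnRes l 1) ∨ (DecOnRes l 0 ∧ DecOnRes l 1))

/-- A vertical wedge alternation: a vertical alternation of even length for which one of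
the odd-position and even-position subsequences is increasing and the other decreasing. -/
def IsVertWedge (l : List ℕ) : Prop :=
  VerticalAlternation l ∧ Even l.length ∧
    ((IncOnRes l 0 ∧ DecOnRes l 1) ∨ (DecOnRes l 0 ∧ IncOnRes l 1))

/-- The vertical parallel alternation `σ_m`, with `σ_m(2i−1) = m+1−i` and
`σ_m(2i) = 2m+1−i` (1-indexed). -/
def sigmaAlt (m : ℕ) : List ℕ :=
  (List.range (2 * m)).map (fun j => if j % 2 = 0 then m - j / 2 else 2 * m - j / 2)

/-- The vertical wedge alternation `τ_m`, with `τ_m(2i−1) = m+i` and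
`τ_m(2i) = m+1−i` (1-indexed). -/
def tauAlt (m : ℕ) : List ℕ :=
  (List.range (2 * m)).map (fun j => if j % 2 = 0 then m + j / 2 + 1 else m - j / 2)

/-- Standardization: replace each entry of `l` by its rank among the entries of `l`. -/
def stList (l : List ℕ) : List ℕ :=
  l.map (fun x => (l.filter (fun y => y ≤ x)).length)

/-- `f` is strictly increasing on the index interval `[a, b)`. -/
def IncOn (f : ℕ → ℕ) (a b : ℕ) : Prop :=
  ∀ x y, a ≤ x → x < y → y < b → f x < f y

/-- Every value of `f` on `[a, b)` lies above every value on `[b, c)`. -/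
def AboveOn (f : ℕ → ℕ) (a b c : ℕ) : Prop :=
  ∀ x y, a ≤ x → x < b → b ≤ y → y < c → f y < f x

/-- Inserting a new maximum at position `i` of the sequence `f 0, …, f (n - 1)` creates
neither a `4321` nor a `3142`. -/
def Active (f : ℕ → ℕ) (n i : ℕ) : Prop :=
  i ≤ n ∧ (∀ x y z, i ≤ x → x < y → y < z → z < n → f z < f y → f y < f x → False) ∧
    ∀ x y z, x < y → y < i → i ≤ z → z < n → f y < f z → f z < f x → False

/-- The part of the sequence from position `i` on is a skew sum of two nonempty increasing
sequences, the second one starting at the active site `j`. -/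
def SplitsAt (f : ℕ → ℕ) (n i j : ℕ) : Prop :=
  i < j ∧ j < n ∧ Active f n j ∧ IncOn f i j ∧ IncOn f j n ∧ AboveOn f i j n

/-- The sequence obtained from `f` by inserting `M` at position `i`. -/
def insertAt (f : ℕ → ℕ) (i M : ℕ) : ℕ → ℕ :=
  fun k => if k < i then f k else if k = i then M else f (k - 1)

/-- An active site followed by a descent. -/
def DescSite (f : ℕ → ℕ) (n k : ℕ) : Prop :=
  Active f n k ∧ ¬ IncOn f k n

/-- An active site followed by a skew sum of two increasing sequences that meet at an
active site. -/
def SkewSite (f : ℕ → ℕ) (n k : ℕ) : Prop :=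
  Active f n k ∧ ∃ j, SplitsAt f n k j

/-- An active site, other than the last one, followed by an increasing sequence. -/
def IncSite (f : ℕ → ℕ) (n k : ℕ) : Prop :=
  k < n ∧ Active f n k ∧ IncOn f k n

section insertion

variable {f : ℕ → ℕ} {n i M : ℕ}

theorem insertAt_of_lt {k : ℕ} (h : k < i) : insertAt f i M k = f k := by
  simp [insertAt, h]

theorem insertAt_self : insertAt f i M i = M := by
  simp [insertAt]

theorem insertAt_succ {k : ℕ} (h : i ≤ k) : insertAt f i M (k + 1) = f k := by
  simp [insertAt, show ¬ k + 1 < i by omega, show k + 1 ≠ i by omega]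

theorem insertAt_of_gt {k : ℕ} (h : i < k) : insertAt f i M k = f (k - 1) := by
  simp [insertAt, show ¬ k < i by omega, show k ≠ i by omega]

/-- Every position of the sequence survives in the longer one. -/
theorem exists_insertAt_eq (f : ℕ → ℕ) (i M x : ℕ) :
    ∃ x', insertAt f i M x' = f x ∧ (x < i ∧ x' = x ∨ i ≤ x ∧ x' = x + 1) := by
  rcases lt_or_ge x i with h | h
  · exact ⟨x, insertAt_of_lt h, Or.inl ⟨h, rfl⟩⟩
  · exact ⟨x + 1, insertAt_succ h, Or.inr ⟨h, rfl⟩⟩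

/-- Every position of the longer sequence is the new one or comes from an old one. -/
theorem insertAt_cases (f : ℕ → ℕ) (i M x : ℕ) :
    (x = i ∧ insertAt f i M x = M) ∨
      ∃ x', insertAt f i M x = f x' ∧ (x' < i ∧ x = x' ∨ i ≤ x' ∧ x = x' + 1) := by
  rcases lt_trichotomy x i with h | h | h
  · exact Or.inr ⟨x, insertAt_of_lt h, Or.inl ⟨h, rfl⟩⟩
  · exact Or.inl ⟨h, h ▸ insertAt_self⟩
  · exact Or.inr ⟨x - 1, insertAt_of_gt h, Or.inr ⟨by omega, by omega⟩⟩

theorem active_insertAt_of_le (hM : ∀ k < n, f k < M) (hi : i ≤ n)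
    (hinj : ∀ x y, x < y → y < n → f x ≠ f y) {k : ℕ} (hk : k ≤ i) :
    Active (insertAt f i M) (n + 1) k ↔ Active f n k ∧ IncOn f i n := by
  constructor
  · rintro ⟨h0, h1, h2⟩
    refine ⟨⟨by omega, ?_, ?_⟩, ?_⟩
    · intro x y z a b c d e g
      obtain ⟨x', hx, hx'⟩ := exists_insertAt_eq f i M x
      obtain ⟨y', hy, hy'⟩ := exists_insertAt_eq f i M y
      obtain ⟨z', hz, hz'⟩ := exists_insertAt_eq f i M z
      exact h1 x' y' z' (by omega) (by omega) (by omega) (by omega) (by omega) (by omega)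
    · intro x y z a b c d e g
      obtain ⟨x', hx, hx'⟩ := exists_insertAt_eq f i M x
      obtain ⟨y', hy, hy'⟩ := exists_insertAt_eq f i M y
      obtain ⟨z', hz, hz'⟩ := exists_insertAt_eq f i M z
      exact h2 x' y' z' (by omega) (by omega) (by omega) (by omega) (by omega) (by omega)
    · intro x y a b c
      by_contra hlt
      have := hinj x y b c
      have := hM x (by omega)
      exact h1 i (x + 1) (y + 1) hk (by omega) (by omega) (by omega)
        (by rw [insertAt_succ a, insertAt_succ (by omega)]; omega)
        (by rw [insertAt_succ a, insertAt_self]; omega)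
  · rintro ⟨⟨h0, h1, h2⟩, h3⟩
    refine ⟨by omega, ?_, ?_⟩
    · intro x y z a b c d e g
      rcases insertAt_cases f i M z with ⟨hz, hz'⟩ | ⟨z', hz, hz'⟩
      · rcases insertAt_cases f i M y with ⟨hy, hy'⟩ | ⟨y', hy, hy'⟩
        · omega
        · have := hM y' (by omega)
          omega
      rcases insertAt_cases f i M y with ⟨hy, hy'⟩ | ⟨y', hy, hy'⟩
      · rcases insertAt_cases f i M x with ⟨hx, hx'⟩ | ⟨x', hx, hx'⟩
        · omega
        · have := hM x' (by omega)
          omega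
      rcases insertAt_cases f i M x with ⟨hx, hx'⟩ | ⟨x', hx, hx'⟩
      · have := h3 y' z' (by omega) (by omega) (by omega)
        omega
      · exact h1 x' y' z' (by omega) (by omega) (by omega) (by omega) (by omega) (by omega)
    · intro x y z a b c d e g
      rcases insertAt_cases f i M z with ⟨hz, hz'⟩ | ⟨z', hz, hz'⟩
      · rcases insertAt_cases f i M x with ⟨hy, hy'⟩ | ⟨y', hy, hy'⟩
        · omega
        · have := hM y' (by omega)
          omega
      rcases insertAt_cases f i M y with ⟨hy, hy'⟩ | ⟨y', hy, hy'⟩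
      · omega
      rcases insertAt_cases f i M x with ⟨hx, hx'⟩ | ⟨x', hx, hx'⟩
      · omega
      · exact h2 x' y' z' (by omega) (by omega) (by omega) (by omega) (by omega) (by omega)

theorem active_insertAt_succ (hM : ∀ k < n, f k < M)
    (hinj : ∀ x y, x < y → y < n → f x ≠ f y) {k : ℕ} (hk : i ≤ k) :
    Active (insertAt f i M) (n + 1) (k + 1) ↔ Active f n k ∧ AboveOn f i k n := by
  constructor
  · rintro ⟨h0, h1, h2⟩
    refine ⟨⟨by omega, ?_, ?_⟩, ?_⟩
    · intro x y z a b c d e g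
      obtain ⟨x', hx, hx'⟩ := exists_insertAt_eq f i M x
      obtain ⟨y', hy, hy'⟩ := exists_insertAt_eq f i M y
      obtain ⟨z', hz, hz'⟩ := exists_insertAt_eq f i M z
      exact h1 x' y' z' (by omega) (by omega) (by omega) (by omega) (by omega) (by omega)
    · intro x y z a b c d e g
      obtain ⟨x', hx, hx'⟩ := exists_insertAt_eq f i M x
      obtain ⟨y', hy, hy'⟩ := exists_insertAt_eq f i M y
      obtain ⟨z', hz, hz'⟩ := exists_insertAt_eq f i M z
      exact h2 x' y' z' (by omega) (by omega) (by omega) (by omega) (by omega) (by omega)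
    · intro x y a b c d
      by_contra hlt
      have := hinj x y (by omega) d
      have := hM y d
      exact h2 i (x + 1) (y + 1) (by omega) (by omega) (by omega) (by omega)
        (by rw [insertAt_succ a, insertAt_succ (by omega)]; omega)
        (by rw [insertAt_succ (by omega), insertAt_self]; omega)
  · rintro ⟨⟨h0, h1, h2⟩, h3⟩
    refine ⟨by omega, ?_, ?_⟩
    · intro x y z a b c d e g
      rcases insertAt_cases f i M z with ⟨hz, hz'⟩ | ⟨z', hz, hz'⟩
      · rcases insertAt_cases f i M y with ⟨hy, hy'⟩ | ⟨y', hy, hy'⟩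
        · omega
        · have := hM y' (by omega)
          omega
      rcases insertAt_cases f i M y with ⟨hy, hy'⟩ | ⟨y', hy, hy'⟩
      · rcases insertAt_cases f i M x with ⟨hx, hx'⟩ | ⟨x', hx, hx'⟩
        · omega
        · have := hM x' (by omega)
          omega
      rcases insertAt_cases f i M x with ⟨hx, hx'⟩ | ⟨x', hx, hx'⟩
      · omega
      · exact h1 x' y' z' (by omega) (by omega) (by omega) (by omega) (by omega) (by omega)
    · intro x y z a b c d e g
      rcases insertAt_cases f i M z with ⟨hz, hz'⟩ | ⟨z', hz, hz'⟩
      · rcases insertAt_cases f i M x with ⟨hy, hy'⟩ | ⟨y', hy, hy'⟩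
        · omega
        · have := hM y' (by omega)
          omega
      rcases insertAt_cases f i M y with ⟨hy, hy'⟩ | ⟨y', hy, hy'⟩
      · rcases insertAt_cases f i M x with ⟨hx, hx'⟩ | ⟨x', hx, hx'⟩
        · omega
        · have := hM z' (by omega)
          omega
      rcases insertAt_cases f i M x with ⟨hx, hx'⟩ | ⟨x', hx, hx'⟩
      · have := h3 y' z' (by omega) (by omega) (by omega) (by omega)
        omega
      · exact h2 x' y' z' (by omega) (by omega) (by omega) (by omega) (by omega) (by omega)

theorem incOn_insertAt_of_le (hM : ∀ k < n, f k < M) (hi : i ≤ n) {k : ℕ} (hk : k ≤ i) :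
    IncOn (insertAt f i M) k (n + 1) ↔ i = n ∧ IncOn f k n := by
  constructor
  · intro h
    have hin : i = n := by
      by_contra hne
      have h1 := h i (i + 1) hk (by omega) (by omega)
      rw [insertAt_self, insertAt_succ le_rfl] at h1
      have := hM i (by omega)
      omega
    refine ⟨hin, fun x y a b c => ?_⟩
    have h1 := h x y a b (by omega)
    rwa [insertAt_of_lt (by omega), insertAt_of_lt (by omega)] at h1
  · rintro ⟨rfl, h⟩ x y a b c
    have hx := insertAt_cases f i M x
    have hy := insertAt_cases f i M y
    grind [IncOn]

theorem incOn_insertAt_succ {k m : ℕ} (hk : i ≤ k) :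
    IncOn (insertAt f i M) (k + 1) (m + 1) ↔ IncOn f k m := by
  constructor
  · intro h x y a b c
    have h1 := h (x + 1) (y + 1) (by omega) (by omega) (by omega)
    rwa [insertAt_succ (by omega), insertAt_succ (by omega)] at h1
  · intro h x y a b c
    rw [insertAt_of_gt (by omega), insertAt_of_gt (by omega)]
    exact h _ _ (by omega) (by omega) (by omega)

theorem aboveOn_insertAt_succ {k j m : ℕ} (hk : i ≤ k) :
    AboveOn (insertAt f i M) (k + 1) (j + 1) (m + 1) ↔ AboveOn f k j m := by
  constructor
  · intro h x y a b c d
    have h1 := h (x + 1) (y + 1) (by omega) (by omega) (by omega) (by omega)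
    rwa [insertAt_succ (by omega), insertAt_succ (by omega)] at h1
  · intro h x y a b c d
    rw [insertAt_of_gt (by omega), insertAt_of_gt (by omega)]
    exact h _ _ (by omega) (by omega) (by omega) (by omega)

theorem splitsAt_insertAt_succ (hM : ∀ k < n, f k < M)
    (hinj : ∀ x y, x < y → y < n → f x ≠ f y) {k j : ℕ} (hk : i ≤ k) :
    SplitsAt (insertAt f i M) (n + 1) (k + 1) (j + 1) ↔
      SplitsAt f n k j ∧ AboveOn f i j n := by
  unfold SplitsAt
  constructor
  · rintro ⟨a, b, c, d, e, g⟩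
    rw [active_insertAt_succ hM hinj (by omega)] at c
    exact ⟨⟨by omega, by omega, c.1, (incOn_insertAt_succ hk).1 d,
      (incOn_insertAt_succ (by omega)).1 e, (aboveOn_insertAt_succ hk).1 g⟩, c.2⟩
  · rintro ⟨⟨a, b, c, d, e, g⟩, h⟩
    exact ⟨by omega, by omega, (active_insertAt_succ hM hinj (by omega)).2 ⟨c, h⟩,
      (incOn_insertAt_succ hk).2 d, (incOn_insertAt_succ (by omega)).2 e,
      (aboveOn_insertAt_succ hk).2 g⟩

theorem splitsAt_insertAt_of_le (hM : ∀ k < n, f k < M) (hi : Active f n i)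
    (hinj : ∀ x y, x < y → y < n → f x ≠ f y) {k j : ℕ} (hk : k ≤ i) :
    SplitsAt (insertAt f i M) (n + 1) k j ↔
      j = i + 1 ∧ i < n ∧ IncOn f k i ∧ IncOn f i n ∧ AboveOn f k i n := by
  have hin := hi.1
  constructor
  · rintro ⟨a, b, c, d, e, g⟩
    have hj : j = i + 1 := by
      rcases lt_trichotomy j (i + 1) with h | h | h
      · have h1 := g k i le_rfl a (by omega) (by omega)
        rw [insertAt_self, insertAt_of_lt (by omega)] at h1
        have := hM k (by omega)
        omega
      · exact h
      · have h1 := d i (i + 1) hk (by omega) h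
        rw [insertAt_self, insertAt_succ le_rfl] at h1
        have := hM i (by omega)
        omega
    subst hj
    refine ⟨rfl, by omega, ?_, (incOn_insertAt_succ le_rfl).1 e, ?_⟩
    · intro x y p q r
      have h1 := d x y p q (by omega)
      rwa [insertAt_of_lt (by omega), insertAt_of_lt (by omega)] at h1
    · intro x y p q r s
      have h1 := g x (y + 1) p (by omega) (by omega) (by omega)
      rwa [insertAt_of_lt q, insertAt_succ r] at h1
  · rintro ⟨rfl, a, b, c, d⟩
    refine ⟨by omega, by omega, (active_insertAt_succ hM hinj le_rfl).2 ⟨hi, ?_⟩, ?_,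
      (incOn_insertAt_succ le_rfl).2 c, ?_⟩
    · intro x y; omega
    · intro x y p q r
      have hx := insertAt_cases f i M x
      have hy := insertAt_cases f i M y
      grind [IncOn]
    · intro x y p q r s
      have hx := insertAt_cases f i M x
      have hy := insertAt_cases f i M y
      grind [AboveOn]


theorem incOn_of_le {k m : ℕ} (h : m ≤ k + 1) : IncOn f k m := by
  intro x y; omega

theorem IncOn.mono {k k' m : ℕ} (h : IncOn f k m) (hk : k ≤ k') : IncOn f k' m :=
  fun x y a b c => h x y (hk.trans a) b c

theorem descSite_insertAt_end (hM : ∀ k < n, f k < M)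
    (hinj : ∀ x y, x < y → y < n → f x ≠ f y) {k : ℕ} :
    DescSite (insertAt f n M) (n + 1) k ↔ DescSite f n k := by
  unfold DescSite
  rcases le_or_gt k n with h | h
  · rw [active_insertAt_of_le hM le_rfl hinj h, incOn_insertAt_of_le hM le_rfl h]
    simp [incOn_of_le (f := f) (show n ≤ n + 1 by omega)]
  · constructor
    · rintro ⟨-, h2⟩
      exact absurd (incOn_of_le (by omega)) h2
    · rintro ⟨h1, -⟩
      exact absurd h1.1 (by omega)

theorem incSite_insertAt_end (hM : ∀ k < n, f k < M) (hi : Active f n n)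
    (hinj : ∀ x y, x < y → y < n → f x ≠ f y) {k : ℕ} :
    IncSite (insertAt f n M) (n + 1) k ↔ k = n ∨ IncSite f n k := by
  have h0 : IncOn f n n := incOn_of_le (by omega)
  unfold IncSite
  rcases lt_trichotomy k n with h | rfl | h
  · rw [active_insertAt_of_le hM le_rfl hinj h.le, incOn_insertAt_of_le hM le_rfl h.le]
    simp [h0, h.ne, h, h.trans]
  · rw [active_insertAt_of_le hM le_rfl hinj le_rfl, incOn_insertAt_of_le hM le_rfl le_rfl]
    simp [h0, hi]
  · omega

theorem not_skewSite_insertAt_end (hM : ∀ k < n, f k < M) (hi : Active f n n)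
    (hinj : ∀ x y, x < y → y < n → f x ≠ f y) {k : ℕ} :
    ¬ SkewSite (insertAt f n M) (n + 1) k := by
  rintro ⟨-, j, hj⟩
  rcases le_or_gt k n with h | h
  · rw [splitsAt_insertAt_of_le hM hi hinj h] at hj
    omega
  · have := hj.1
    have := hj.2.1
    omega

theorem not_aboveOn_of_incOn {k : ℕ} (hinc : IncOn f i n) (hk : i < k) (hkn : k < n) :
    ¬ AboveOn f i k n := by
  intro h
  have h1 := h i k le_rfl hk le_rfl hkn
  have h2 := hinc i k le_rfl hk hkn
  omega

theorem aboveOn_of_le {k m l : ℕ} (h : m ≤ k ∨ l ≤ m) : AboveOn f k m l := by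
  intro x y; omega

theorem SplitsAt.not_incOn {j : ℕ} (h : SplitsAt f n i j) : ¬ IncOn f i n := fun h' =>
  not_aboveOn_of_incOn h' h.1 h.2.1 h.2.2.2.2.2

theorem SplitsAt.le_of_incOn {j k : ℕ} (h : SplitsAt f n k j) (hinc : IncOn f i n) : j ≤ i := by
  by_contra hlt
  obtain ⟨a, b, -, -, -, e⟩ := h
  have h1 := e (j - 1) j (by omega) (by omega) le_rfl b
  have h2 := hinc (j - 1) j (by omega) (by omega) b
  omega

theorem descSite_insertAt_incSite (hM : ∀ k < n, f k < M) (hi : IncSite f n i)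
    (hinj : ∀ x y, x < y → y < n → f x ≠ f y) {k : ℕ} :
    DescSite (insertAt f i M) (n + 1) k ↔ k = i ∨ DescSite f n k ∨ IncSite f n k ∧ k < i := by
  obtain ⟨hin, hact, hinc⟩ := hi
  unfold DescSite IncSite
  rcases le_or_gt k i with h | h
  · rw [active_insertAt_of_le hM hin.le hinj h, incOn_insertAt_of_le hM hin.le h]
    by_cases hk : IncOn f k n
    · rcases h.eq_or_lt with rfl | h'
      · simp [hact, hinc, hin.ne]
      · simp [hinc, hin.ne, h', h'.ne, hk, h'.trans hin]
    · have : k ≠ i := by rintro rfl; exact hk hinc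
      simp [this, hinc, hin.ne, hk]
  · obtain ⟨k, rfl⟩ : ∃ k', k = k' + 1 := ⟨k - 1, by omega⟩
    rw [incOn_insertAt_succ (by omega)]
    have h1 : IncOn f k n := hinc.mono (by omega)
    have h2 : IncOn f (k + 1) n := hinc.mono (by omega)
    simp [h1, h2]
    omega

theorem incSite_insertAt_incSite (hM : ∀ k < n, f k < M) (hi : IncSite f n i)
    (hinj : ∀ x y, x < y → y < n → f x ≠ f y) {k : ℕ} :
    IncSite (insertAt f i M) (n + 1) k ↔ k = i + 1 := by
  obtain ⟨hin, hact, hinc⟩ := hi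
  unfold IncSite
  rcases le_or_gt k i with h | h
  · rw [incOn_insertAt_of_le hM hin.le h]
    omega
  · obtain ⟨k, rfl⟩ : ∃ k', k = k' + 1 := ⟨k - 1, by omega⟩
    rw [incOn_insertAt_succ (by omega), active_insertAt_succ hM hinj (by omega)]
    constructor
    · rintro ⟨a, ⟨b, c⟩, d⟩
      by_contra hne
      exact not_aboveOn_of_incOn hinc (by omega) (by omega) c
    · intro h'
      obtain rfl : k = i := by omega
      exact ⟨by omega, ⟨hact, aboveOn_of_le (by omega)⟩, hinc⟩

theorem skewSite_insertAt_incSite (hM : ∀ k < n, f k < M) (hi : IncSite f n i)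
    (hinj : ∀ x y, x < y → y < n → f x ≠ f y) {k : ℕ} :
    SkewSite (insertAt f i M) (n + 1) k ↔
      k = i ∨ SkewSite f n k ∧ ∀ k' < i, ¬ IncSite f n k' := by
  obtain ⟨hin, hact, hinc⟩ := hi
  unfold SkewSite
  rcases le_or_gt k i with h | h
  · rw [active_insertAt_of_le hM hin.le hinj h]
    simp only [splitsAt_insertAt_of_le hM hact hinj h]
    constructor
    · rintro ⟨⟨a, -⟩, j, rfl, b, c, d, e⟩
      rcases h.eq_or_lt with rfl | h'
      · exact Or.inl rfl
      · refine Or.inr ⟨⟨a, i, h', hin, hact, c, d, e⟩, ?_⟩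
        rintro k' hk' ⟨p, -, q⟩
        have h1 := q (max k k') i (le_max_right _ _) (max_lt h' hk') hin
        have h2 := e (max k k') i (le_max_left _ _) (max_lt h' hk') le_rfl hin
        omega
    · rintro (rfl | ⟨⟨a, j, hj⟩, b⟩)
      · exact ⟨⟨hact, hinc⟩, k + 1, rfl, hin, incOn_of_le (by omega), hinc,
          aboveOn_of_le (by omega)⟩
      · have hki : k < i := by
          rcases h.eq_or_lt with rfl | h'
          · exact absurd hinc hj.not_incOn
          · exact h'
        have hle := hj.le_of_incOn hinc
        obtain ⟨p, q, r, s, t, u⟩ := hj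
        have : ¬ j < i := fun hlt => b j hlt ⟨q, r, t⟩
        obtain rfl : j = i := by omega
        exact ⟨⟨a, hinc⟩, j + 1, rfl, hin, s, t, u⟩
  · obtain ⟨k, rfl⟩ : ∃ k', k = k' + 1 := ⟨k - 1, by omega⟩
    constructor
    · rintro ⟨-, j, hj⟩
      exact absurd ((incOn_insertAt_succ (by omega)).2 (hinc.mono (by omega))) hj.not_incOn
    · rintro (h' | ⟨⟨-, j, hj⟩, -⟩)
      · omega
      · exact absurd (hinc.mono h.le) hj.not_incOn

/-- Between a site followed by a descent and a later active site that becomes a skew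
splitting point, the sequence is increasing. -/
theorem splitsAt_of_aboveOn (hi : Active f n i) (hinj : ∀ x y, x < y → y < n → f x ≠ f y)
    {k : ℕ} (hk : i < k) (hkn : k < n) (hact : Active f n k) (h : AboveOn f i k n) :
    SplitsAt f n i k := by
  refine ⟨hk, hkn, hact, ?_, ?_, h⟩
  · intro x y a b c
    by_contra hlt
    have := hinj x y b (by omega)
    exact hi.2.1 x y k a b c hkn (h y k (by omega) c le_rfl hkn) (by omega)
  · intro x y a b c
    by_contra hlt
    have := hinj x y b (by omega)
    exact hi.2.1 i x y le_rfl (by omega) b c (by omega) (h i x le_rfl hk a (by omega))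

theorem SplitsAt.unique {j j' : ℕ} (h : SplitsAt f n i j) (h' : SplitsAt f n i j') :
    j = j' := by
  by_contra hne
  wlog hlt : j < j' generalizing j j'
  · exact this h' h (Ne.symm hne) (by omega)
  have h1 := h.2.2.2.2.1 j j' le_rfl hlt h'.2.1
  have h2 := h'.2.2.2.2.2 j j' h.1.le hlt le_rfl h'.2.1
  omega

theorem descSite_insertAt_descSite (hM : ∀ k < n, f k < M) (hi : DescSite f n i)
    (hinj : ∀ x y, x < y → y < n → f x ≠ f y) {k : ℕ} :
    DescSite (insertAt f i M) (n + 1) k ↔ k = i + 1 := by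
  obtain ⟨hact, hinc⟩ := hi
  have hin := hact.1
  unfold DescSite
  rcases le_or_gt k i with h | h
  · rw [active_insertAt_of_le hM hin hinj h]
    simp only [hinc, and_false, false_and, false_iff]
    omega
  · obtain ⟨k, rfl⟩ : ∃ k', k = k' + 1 := ⟨k - 1, by omega⟩
    rw [incOn_insertAt_succ (by omega), active_insertAt_succ hM hinj (by omega)]
    constructor
    · rintro ⟨⟨b, c⟩, d⟩
      by_contra hne
      rcases b.1.eq_or_lt with rfl | hkn
      · exact d (incOn_of_le (by omega))
      · exact d (splitsAt_of_aboveOn hact hinj (by omega) hkn b c).2.2.2.2.1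
    · intro h'
      obtain rfl : k = i := by omega
      exact ⟨⟨hact, aboveOn_of_le (by omega)⟩, hinc⟩

theorem incSite_insertAt_descSite (hM : ∀ k < n, f k < M) (hi : DescSite f n i)
    (hinj : ∀ x y, x < y → y < n → f x ≠ f y) {k : ℕ} :
    IncSite (insertAt f i M) (n + 1) k ↔ ∃ j, SplitsAt f n i j ∧ k = j + 1 := by
  obtain ⟨hact, hinc⟩ := hi
  have hin := hact.1
  unfold IncSite
  rcases le_or_gt k i with h | h
  · rw [active_insertAt_of_le hM hin hinj h]
    simp only [hinc, and_false, false_and, false_iff]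
    rintro ⟨j, hj, rfl⟩
    have := hj.1
    omega
  · obtain ⟨k, rfl⟩ : ∃ k', k = k' + 1 := ⟨k - 1, by omega⟩
    rw [incOn_insertAt_succ (by omega), active_insertAt_succ hM hinj (by omega)]
    constructor
    · rintro ⟨a, ⟨b, c⟩, d⟩
      have hne : i ≠ k := by rintro rfl; exact hinc d
      exact ⟨k, splitsAt_of_aboveOn hact hinj (by omega) (by omega) b c, rfl⟩
    · rintro ⟨j, hj, hkj⟩
      obtain rfl : k = j := by omega
      obtain ⟨p, q, r, s, t, u⟩ := hj
      exact ⟨by omega, ⟨r, u⟩, t⟩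

theorem skewSite_insertAt_descSite (hM : ∀ k < n, f k < M) (hi : DescSite f n i)
    (hinj : ∀ x y, x < y → y < n → f x ≠ f y) {k : ℕ} :
    SkewSite (insertAt f i M) (n + 1) k ↔ SkewSite f n i ∧ k = i + 1 := by
  have hdesc := descSite_insertAt_descSite (k := k) hM hi hinj
  obtain ⟨hact, hinc⟩ := hi
  constructor
  · rintro ⟨h1, j, hj⟩
    obtain rfl := hdesc.1 ⟨h1, hj.not_incOn⟩
    obtain ⟨j, rfl⟩ : ∃ j', j = j' + 1 := ⟨j - 1, by have := hj.1; omega⟩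
    exact ⟨⟨hact, j, ((splitsAt_insertAt_succ hM hinj le_rfl).1 hj).1⟩, rfl⟩
  · rintro ⟨⟨-, j, hj⟩, rfl⟩
    exact ⟨(hdesc.2 rfl).1, j + 1,
      (splitsAt_insertAt_succ hM hinj le_rfl).2 ⟨hj, hj.2.2.2.2.2⟩⟩

/-- The sequence `f 0, …, f (n - 1)` contains neither `4321` nor `3142`. -/
def AvoidsBoth (f : ℕ → ℕ) (n : ℕ) : Prop :=
  (∀ x y z w, x < y → y < z → z < w → w < n → f w < f z → f z < f y → f y < f x → False) ∧
    ∀ x y z w, x < y → y < z → z < w → w < n → f y < f w → f w < f x → f x < f z → False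

theorem avoidsBoth_insertAt (hM : ∀ k < n, f k < M) (hi : i ≤ n) :
    AvoidsBoth (insertAt f i M) (n + 1) ↔ AvoidsBoth f n ∧ Active f n i := by
  constructor
  · rintro ⟨h1, h2⟩
    refine ⟨⟨?_, ?_⟩, hi, ?_, ?_⟩
    · intro x y z w a b c d e g h
      obtain ⟨x', hx, hx'⟩ := exists_insertAt_eq f i M x
      obtain ⟨y', hy, hy'⟩ := exists_insertAt_eq f i M y
      obtain ⟨z', hz, hz'⟩ := exists_insertAt_eq f i M z
      obtain ⟨w', hw, hw'⟩ := exists_insertAt_eq f i M w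
      exact h1 x' y' z' w' (by omega) (by omega) (by omega) (by omega) (by omega) (by omega)
        (by omega)
    · intro x y z w a b c d e g h
      obtain ⟨x', hx, hx'⟩ := exists_insertAt_eq f i M x
      obtain ⟨y', hy, hy'⟩ := exists_insertAt_eq f i M y
      obtain ⟨z', hz, hz'⟩ := exists_insertAt_eq f i M z
      obtain ⟨w', hw, hw'⟩ := exists_insertAt_eq f i M w
      exact h2 x' y' z' w' (by omega) (by omega) (by omega) (by omega) (by omega) (by omega)
        (by omega)
    · intro x y z a b c d e g
      have := hM x (by omega)
      have hi' := insertAt_self (f := f) (i := i) (M := M)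
      have hx := insertAt_succ (f := f) (M := M) a
      have hy := insertAt_succ (f := f) (M := M) (show i ≤ y by omega)
      have hz := insertAt_succ (f := f) (M := M) (show i ≤ z by omega)
      exact h1 i (x + 1) (y + 1) (z + 1) (by omega) (by omega) (by omega) (by omega) (by omega)
        (by omega) (by omega)
    · intro x y z a b c d e g
      have := hM x (by omega)
      have hi' := insertAt_self (f := f) (i := i) (M := M)
      have hx := insertAt_of_lt (f := f) (M := M) (show x < i by omega)
      have hy := insertAt_of_lt (f := f) (M := M) b
      have hz := insertAt_succ (f := f) (M := M) c
      exact h2 x y i (z + 1) (by omega) (by omega) (by omega) (by omega) (by omega) (by omega)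
        (by omega)
  · rintro ⟨⟨h1, h2⟩, -, h3, h4⟩
    constructor
    · intro x y z w a b c d e g h
      rcases insertAt_cases f i M w with ⟨hw, hw'⟩ | ⟨w', hw, hw'⟩
      · rcases insertAt_cases f i M z with ⟨hz, hz'⟩ | ⟨z', hz, hz'⟩
        · omega
        · have := hM z' (by omega)
          omega
      rcases insertAt_cases f i M z with ⟨hz, hz'⟩ | ⟨z', hz, hz'⟩
      · rcases insertAt_cases f i M y with ⟨hy, hy'⟩ | ⟨y', hy, hy'⟩
        · omega
        · have := hM y' (by omega)
          omega
      rcases insertAt_cases f i M y with ⟨hy, hy'⟩ | ⟨y', hy, hy'⟩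
      · rcases insertAt_cases f i M x with ⟨hx, hx'⟩ | ⟨x', hx, hx'⟩
        · omega
        · have := hM x' (by omega)
          omega
      rcases insertAt_cases f i M x with ⟨hx, hx'⟩ | ⟨x', hx, hx'⟩
      · exact h3 y' z' w' (by omega) (by omega) (by omega) (by omega) (by omega) (by omega)
      · exact h1 x' y' z' w' (by omega) (by omega) (by omega) (by omega) (by omega) (by omega)
          (by omega)
    · intro x y z w a b c d e g h
      rcases insertAt_cases f i M y with ⟨hy, hy'⟩ | ⟨y', hy, hy'⟩
      · rcases insertAt_cases f i M w with ⟨hw, hw'⟩ | ⟨w', hw, hw'⟩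
        · omega
        · have := hM w' (by omega)
          omega
      rcases insertAt_cases f i M w with ⟨hw, hw'⟩ | ⟨w', hw, hw'⟩
      · rcases insertAt_cases f i M x with ⟨hx, hx'⟩ | ⟨x', hx, hx'⟩
        · omega
        · have := hM x' (by omega)
          omega
      rcases insertAt_cases f i M x with ⟨hx, hx'⟩ | ⟨x', hx, hx'⟩
      · rcases insertAt_cases f i M z with ⟨hz, hz'⟩ | ⟨z', hz, hz'⟩
        · omega
        · have := hM z' (by omega)
          omega
      rcases insertAt_cases f i M z with ⟨hz, hz'⟩ | ⟨z', hz, hz'⟩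
      · exact h4 x' y' w' (by omega) (by omega) (by omega) (by omega) (by omega) (by omega)
      · exact h2 x' y' z' w' (by omega) (by omega) (by omega) (by omega) (by omega) (by omega)
          (by omega)

end insertion

open Classical in
/-- The finset of active sites followed by a descent. -/
noncomputable def descSites (f : ℕ → ℕ) (n : ℕ) : Finset ℕ :=
  (Finset.range (n + 1)).filter (DescSite f n)

open Classical in
/-- The finset of skew sites. -/
noncomputable def skewSites (f : ℕ → ℕ) (n : ℕ) : Finset ℕ :=
  (Finset.range (n + 1)).filter (SkewSite f n)

open Classical in
/-- The finset of active sites, other than the last one, followed by an increasing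
sequence. -/
noncomputable def incSites (f : ℕ → ℕ) (n : ℕ) : Finset ℕ :=
  (Finset.range (n + 1)).filter (IncSite f n)

open Classical in
/-- The finset of active sites. -/
noncomputable def activeSites (f : ℕ → ℕ) (n : ℕ) : Finset ℕ :=
  (Finset.range (n + 1)).filter (Active f n)

section counting

variable {f : ℕ → ℕ} {n i M : ℕ}

theorem mem_activeSites {k : ℕ} : k ∈ activeSites f n ↔ Active f n k := by
  simp only [activeSites, Finset.mem_filter, Finset.mem_range, and_iff_right_iff_imp]
  exact fun h => Nat.lt_succ_of_le h.1

theorem mem_descSites {k : ℕ} : k ∈ descSites f n ↔ DescSite f n k := by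
  simp only [descSites, Finset.mem_filter, Finset.mem_range, and_iff_right_iff_imp]
  exact fun h => Nat.lt_succ_of_le h.1.1

theorem mem_skewSites {k : ℕ} : k ∈ skewSites f n ↔ SkewSite f n k := by
  simp only [skewSites, Finset.mem_filter, Finset.mem_range, and_iff_right_iff_imp]
  exact fun h => Nat.lt_succ_of_le h.1.1

theorem mem_incSites {k : ℕ} : k ∈ incSites f n ↔ IncSite f n k := by
  simp only [incSites, Finset.mem_filter, Finset.mem_range, and_iff_right_iff_imp]
  exact fun h => Nat.lt_succ_of_lt h.1

theorem SkewSite.descSite {k : ℕ} (h : SkewSite f n k) : DescSite f n k :=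
  ⟨h.1, h.2.choose_spec.not_incOn⟩

theorem skewSites_subset : skewSites f n ⊆ descSites f n := fun _ hk =>
  mem_descSites.2 (mem_skewSites.1 hk).descSite

theorem disjoint_descSites_incSites : Disjoint (descSites f n) (incSites f n) :=
  Finset.disjoint_left.2 fun _ h h' => (mem_descSites.1 h).2 (mem_incSites.1 h').2.2

theorem active_last : Active f n n :=
  ⟨le_rfl, by intros; omega, by intros; omega⟩

theorem activeSites_eq :
    activeSites f n = insert n (incSites f n ∪ descSites f n) := by
  ext k
  simp only [Finset.mem_insert, Finset.mem_union, mem_activeSites, mem_incSites, mem_descSites]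
  constructor
  · intro h
    by_cases hk : IncOn f k n
    · rcases h.1.eq_or_lt with h' | h'
      · exact Or.inl h'
      · exact Or.inr (Or.inl ⟨h', h, hk⟩)
    · exact Or.inr (Or.inr ⟨h, hk⟩)
  · rintro (rfl | h | h)
    · exact active_last
    · exact h.2.1
    · exact h.1

theorem sum_activeSites (g : ℕ → ℤ) :
    ∑ k ∈ activeSites f n, g k =
      g n + ∑ k ∈ incSites f n, g k + ∑ k ∈ skewSites f n, g k +
        ∑ k ∈ descSites f n \ skewSites f n, g k := by
  have h1 : n ∉ incSites f n ∪ descSites f n := by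
    rw [Finset.mem_union, mem_incSites, mem_descSites]
    rintro (h | h)
    · exact lt_irrefl _ h.1
    · exact h.2 (incOn_of_le (by omega))
  rw [activeSites_eq, Finset.sum_insert h1,
    Finset.sum_union disjoint_descSites_incSites.symm,
    ← Finset.sum_sdiff (skewSites_subset (f := f) (n := n))]
  ring

/-- The numbers of sites of the three kinds determine the succession rule. -/
noncomputable def siteEval (g : ℕ → ℕ → ℕ → ℤ) (f : ℕ → ℕ) (n : ℕ) : ℤ :=
  g (descSites f n).card (skewSites f n).card (incSites f n).card

theorem siteEval_insertAt_end (g : ℕ → ℕ → ℕ → ℤ) (hM : ∀ k < n, f k < M)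
    (hinj : ∀ x y, x < y → y < n → f x ≠ f y) :
    siteEval g (insertAt f n M) (n + 1) =
      g (descSites f n).card 0 ((incSites f n).card + 1) := by
  have h1 : descSites (insertAt f n M) (n + 1) = descSites f n := by
    ext k
    rw [mem_descSites, mem_descSites, descSite_insertAt_end hM hinj]
  have h2 : skewSites (insertAt f n M) (n + 1) = ∅ := by
    ext k
    simp [mem_skewSites, not_skewSite_insertAt_end hM active_last hinj]
  have h3 : incSites (insertAt f n M) (n + 1) = insert n (incSites f n) := by
    ext k
    rw [mem_incSites, Finset.mem_insert, mem_incSites, incSite_insertAt_end hM active_last hinj]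
  have h4 : n ∉ incSites f n := fun h => lt_irrefl _ (mem_incSites.1 h).1
  rw [siteEval, h1, h2, h3, Finset.card_insert_of_notMem h4, Finset.card_empty]

theorem siteEval_insertAt_incSite (g : ℕ → ℕ → ℕ → ℤ) (hM : ∀ k < n, f k < M)
    (hi : IncSite f n i) (hinj : ∀ x y, x < y → y < n → f x ≠ f y) :
    siteEval g (insertAt f i M) (n + 1) =
      g ((descSites f n).card + ((incSites f n).filter (· < i)).card + 1)
        ((if ((incSites f n).filter (· < i)).card = 0 then (skewSites f n).card else 0) + 1)
        1 := by
  have hid : i ∉ descSites f n := fun h => (mem_descSites.1 h).2 hi.2.2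
  have h1 : descSites (insertAt f i M) (n + 1) =
      insert i (descSites f n ∪ (incSites f n).filter (· < i)) := by
    ext k
    simp [mem_descSites, mem_incSites, descSite_insertAt_incSite hM hi hinj]
  have h3 : incSites (insertAt f i M) (n + 1) = {i + 1} := by
    ext k
    rw [mem_incSites, Finset.mem_singleton, incSite_insertAt_incSite hM hi hinj]
  have h2 : skewSites (insertAt f i M) (n + 1) =
      insert i (if ((incSites f n).filter (· < i)).card = 0 then skewSites f n else ∅) := by
    ext k
    rw [mem_skewSites, skewSite_insertAt_incSite hM hi hinj, Finset.mem_insert]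
    refine or_congr Iff.rfl ?_
    have hc : ((incSites f n).filter (· < i)).card = 0 ↔ ∀ k, IncSite f n k → ¬ k < i := by
      simp only [Finset.card_eq_zero, Finset.filter_eq_empty_iff, mem_incSites]
    split_ifs with h
    · rw [mem_skewSites]
      exact and_iff_left fun k' hk' h' => hc.1 h k' h' hk'
    · simp only [Finset.notMem_empty, iff_false, not_and]
      exact fun _ h' => h (hc.2 fun k' hk hlt => h' _ hlt hk)
  have h4 : i ∉ descSites f n ∪ (incSites f n).filter (· < i) := by
    simp [hid]
  have h5 : i ∉ (if ((incSites f n).filter (· < i)).card = 0 then skewSites f n else ∅) := by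
    split_ifs
    · exact fun h => hid (skewSites_subset h)
    · simp
  rw [siteEval, h1, h2, h3, Finset.card_insert_of_notMem h4, Finset.card_insert_of_notMem h5,
    Finset.card_union_of_disjoint
      (disjoint_descSites_incSites.mono_right (Finset.filter_subset _ _)), Finset.card_singleton,
    apply_ite Finset.card, Finset.card_empty]

theorem siteEval_insertAt_skewSite (g : ℕ → ℕ → ℕ → ℤ) (hM : ∀ k < n, f k < M)
    (hi : SkewSite f n i) (hinj : ∀ x y, x < y → y < n → f x ≠ f y) :
    siteEval g (insertAt f i M) (n + 1) = g 1 1 1 := by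
  have h1 : descSites (insertAt f i M) (n + 1) = {i + 1} := by
    ext k
    rw [mem_descSites, Finset.mem_singleton, descSite_insertAt_descSite hM hi.descSite hinj]
  have h2 : skewSites (insertAt f i M) (n + 1) = {i + 1} := by
    ext k
    rw [mem_skewSites, Finset.mem_singleton, skewSite_insertAt_descSite hM hi.descSite hinj,
      and_iff_right hi]
  obtain ⟨j, hj⟩ := hi.2
  have h3 : incSites (insertAt f i M) (n + 1) = {j + 1} := by
    ext k
    rw [mem_incSites, Finset.mem_singleton, incSite_insertAt_descSite hM hi.descSite hinj]
    constructor
    · rintro ⟨j', hj', rfl⟩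
      rw [hj'.unique hj]
    · rintro rfl
      exact ⟨j, hj, rfl⟩
  rw [siteEval, h1, h2, h3]
  rfl

theorem siteEval_insertAt_descSite (g : ℕ → ℕ → ℕ → ℤ) (hM : ∀ k < n, f k < M)
    (hi : DescSite f n i) (hi' : ¬ SkewSite f n i)
    (hinj : ∀ x y, x < y → y < n → f x ≠ f y) :
    siteEval g (insertAt f i M) (n + 1) = g 1 0 0 := by
  have h1 : descSites (insertAt f i M) (n + 1) = {i + 1} := by
    ext k
    rw [mem_descSites, Finset.mem_singleton, descSite_insertAt_descSite hM hi hinj]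
  have h2 : skewSites (insertAt f i M) (n + 1) = ∅ := by
    ext k
    simp [mem_skewSites, skewSite_insertAt_descSite hM hi hinj, hi']
  have h3 : incSites (insertAt f i M) (n + 1) = ∅ := by
    ext k
    simp only [mem_incSites, incSite_insertAt_descSite hM hi hinj, Finset.notMem_empty, iff_false]
    rintro ⟨j, hj, -⟩
    exact hi' ⟨hi.1, j, hj⟩
  rw [siteEval, h1, h2, h3]
  rfl

/-- Summing over a finite set of naturals by rank. -/
theorem sum_card_filter_lt (T : Finset ℕ) (F : ℕ → ℤ) :
    ∑ i ∈ T, F (T.filter (· < i)).card = ∑ t ∈ Finset.range T.card, F t := by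
  induction T using Finset.induction_on_max with
  | empty => simp
  | insert a s ha ih =>
    have has : a ∉ s := fun h => lt_irrefl _ (ha a h)
    rw [Finset.sum_insert has, Finset.card_insert_of_notMem has, Finset.sum_range_succ, ← ih,
      add_comm]
    congr 1
    · refine Finset.sum_congr rfl fun i hi => ?_
      rw [Finset.filter_insert, if_neg (not_lt.2 (ha i hi).le)]
    · rw [Finset.filter_insert, if_neg (lt_irrefl a), Finset.filter_true_of_mem ha]

/-- The succession rule of the generating tree. -/
theorem sum_siteEval_insertAt (g : ℕ → ℕ → ℕ → ℤ) (hM : ∀ k < n, f k < M)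
    (hinj : ∀ x y, x < y → y < n → f x ≠ f y) :
    ∑ i ∈ activeSites f n, siteEval g (insertAt f i M) (n + 1) =
      siteEval (fun m q s => g m 0 (s + 1) +
        ∑ t ∈ Finset.range s, g (m + t + 1) ((if t = 0 then q else 0) + 1) 1 +
        q * g 1 1 1 + (m - q) * g 1 0 0) f n := by
  rw [sum_activeSites, siteEval_insertAt_end g hM hinj,
    Finset.sum_congr rfl fun i hi => siteEval_insertAt_incSite g hM (mem_incSites.1 hi) hinj,
    Finset.sum_congr rfl fun i hi => siteEval_insertAt_skewSite g hM (mem_skewSites.1 hi) hinj,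
    Finset.sum_congr rfl fun i hi => siteEval_insertAt_descSite g hM
      (mem_descSites.1 (Finset.mem_sdiff.1 hi).1)
      (fun h => (Finset.mem_sdiff.1 hi).2 (mem_skewSites.2 h)) hinj,
    sum_card_filter_lt (incSites f n) (fun t => g ((descSites f n).card + t + 1)
      ((if t = 0 then (skewSites f n).card else 0) + 1) 1)]
  rw [Finset.sum_const, Finset.sum_const, Finset.card_sdiff_of_subset skewSites_subset,
    nsmul_eq_mul, nsmul_eq_mul, Nat.cast_sub (Finset.card_le_card skewSites_subset)]
  rfl

theorem skewSites_eq_empty (h : incSites f n = ∅) : skewSites f n = ∅ := by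
  ext k
  simp only [mem_skewSites, Finset.notMem_empty, iff_false]
  rintro ⟨-, j, hj⟩
  have : j ∈ incSites f n := mem_incSites.2 ⟨hj.2.1, hj.2.2.1, hj.2.2.2.2.1⟩
  simp [h] at this

end counting

section permutations

open Finset

variable {l : List ℕ} {n : ℕ}

/-- The one-line notation of a permutation as a sequence extended by zero. -/
def toSeq (l : List ℕ) : ℕ → ℕ := fun k => l.getD k 0

theorem toSeq_fin (k : Fin l.length) : l.get k = toSeq l k := by
  simp [toSeq]

theorem pAvoids_iff_avoidsBoth :
    PAvoids l [4, 3, 2, 1] ∧ PAvoids l [3, 1, 4, 2] ↔ AvoidsBoth (toSeq l) l.length := by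
  simp only [PAvoids, PContains, IsOccurrence, not_exists, toSeq_fin (l := l)]
  constructor
  · rintro ⟨h1, h2⟩
    constructor
    · intro x y z w a b c d e g h
      refine h1 ![⟨x, by omega⟩, ⟨y, by omega⟩, ⟨z, by omega⟩, ⟨w, d⟩] ⟨?_, ?_⟩
      · refine Fin.strictMono_iff_lt_succ.2 fun k => ?_
        fin_cases k <;> simpa
      · intro s t
        fin_cases s <;> fin_cases t <;> simp <;> omega
    · intro x y z w a b c d e g h
      refine h2 ![⟨x, by omega⟩, ⟨y, by omega⟩, ⟨z, by omega⟩, ⟨w, d⟩] ⟨?_, ?_⟩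
      · refine Fin.strictMono_iff_lt_succ.2 fun k => ?_
        fin_cases k <;> simpa
      · intro s t
        fin_cases s <;> fin_cases t <;> simp <;> omega
  · rintro ⟨h1, h2⟩
    constructor
    · rintro f ⟨hf, h⟩
      exact h1 (f 0) (f 1) (f 2) (f 3) (hf (by decide)) (hf (by decide)) (hf (by decide)) (f 3).2
        ((h _ _).2 (by decide)) ((h _ _).2 (by decide)) ((h _ _).2 (by decide))
    · rintro f ⟨hf, h⟩
      exact h2 (f 0) (f 1) (f 2) (f 3) (hf (by decide)) (hf (by decide)) (hf (by decide)) (f 3).2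
        ((h _ _).2 (by decide)) ((h _ _).2 (by decide)) ((h _ _).2 (by decide))

theorem toSeq_insertIdx {i M : ℕ} (hi : i ≤ l.length) :
    toSeq (l.insertIdx i M) = insertAt (toSeq l) i M := by
  ext k
  simp only [toSeq, insertAt, List.getD_eq_getElem?_getD, List.getElem?_insertIdx]
  split_ifs <;> first | rfl | omega

open Classical in
/-- The permutations of length `n` avoiding `4321` and `3142`. -/
noncomputable def avoiders (n : ℕ) : Finset (List ℕ) :=
  (incrPerm n).permutations.toFinset.filter fun l => AvoidsBoth (toSeq l) n

theorem mem_avoiders : l ∈ avoiders n ↔ l.Perm (incrPerm n) ∧ AvoidsBoth (toSeq l) n := by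
  simp [avoiders, List.mem_permutations]

theorem length_of_perm (h : l.Perm (incrPerm n)) : l.length = n := by
  simpa [incrPerm] using h.length_eq

theorem toSeq_lt_of_perm (h : l.Perm (incrPerm n)) : ∀ k < n, toSeq l k < n + 1 := by
  intro k hk
  have hl := length_of_perm h
  have : l[k]'(by omega) ∈ incrPerm n := h.mem_iff.1 (List.getElem_mem _)
  simp only [incrPerm, List.mem_map, List.mem_range] at this
  obtain ⟨a, ha, ha'⟩ := this
  rw [toSeq, List.getD_eq_getElem _ _ (by omega)]
  omega

theorem nodup_of_perm (h : l.Perm (incrPerm n)) : l.Nodup :=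
  h.nodup_iff.2 <| List.nodup_range.map fun a b hab => by simpa using hab

theorem toSeq_ne_of_perm (h : l.Perm (incrPerm n)) :
    ∀ x y, x < y → y < n → toSeq l x ≠ toSeq l y := by
  intro x y hxy hy
  have hl := length_of_perm h
  rw [toSeq, toSeq, List.getD_eq_getElem _ _ (by omega), List.getD_eq_getElem _ _ (by omega), Ne,
    (nodup_of_perm h).getElem_inj_iff]
  omega

theorem incrPerm_succ_perm (n : ℕ) : (incrPerm (n + 1)).Perm ((n + 1) :: incrPerm n) := by
  simp only [incrPerm, List.range_succ, List.map_append, List.map_cons, List.map_nil]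
  exact List.perm_append_singleton _ _

theorem insertIdx_mem_avoiders {i : ℕ} (hl : l.Perm (incrPerm n)) (hi : i ≤ n) :
    l.insertIdx i (n + 1) ∈ avoiders (n + 1) ↔ l ∈ avoiders n ∧ i ∈ activeSites (toSeq l) n := by
  have hlen := length_of_perm hl
  have hp : (l.insertIdx i (n + 1)).Perm (incrPerm (n + 1)) :=
    (List.perm_insertIdx _ _ (by omega)).trans ((hl.cons _).trans (incrPerm_succ_perm n).symm)
  rw [mem_avoiders, mem_avoiders, mem_activeSites, toSeq_insertIdx (by omega),
    avoidsBoth_insertAt (toSeq_lt_of_perm hl) hi]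
  tauto

theorem sum_avoiders_succ (n : ℕ) (h : List ℕ → ℤ) :
    ∑ l ∈ avoiders (n + 1), h l =
      ∑ l ∈ avoiders n, ∑ i ∈ activeSites (toSeq l) n, h (l.insertIdx i (n + 1)) := by
  have key : ∀ l ∈ avoiders (n + 1), l.idxOf (n + 1) ≤ n ∧
      (l.eraseIdx (l.idxOf (n + 1))).Perm (incrPerm n) ∧
      (l.eraseIdx (l.idxOf (n + 1))).insertIdx (l.idxOf (n + 1)) (n + 1) = l := by
    intro l hl
    have hp := (mem_avoiders.1 hl).1
    have hm : n + 1 ∈ l := hp.mem_iff.2 ((incrPerm_succ_perm n).mem_iff.2 List.mem_cons_self)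
    have hlt := List.idxOf_lt_length_iff.2 hm
    have hlen := length_of_perm hp
    refine ⟨by omega, ?_, ?_⟩
    · rw [← List.erase_eq_eraseIdx_of_idxOf rfl]
      exact ((List.perm_cons_erase hm).symm.trans (hp.trans (incrPerm_succ_perm n))).cons_inv
    · have := List.insertIdx_eraseIdx_getElem hlt
      rwa [List.getElem_idxOf] at this
  rw [Finset.sum_sigma']
  refine Finset.sum_nbij' (fun l => ⟨l.eraseIdx (l.idxOf (n + 1)), l.idxOf (n + 1)⟩)
    (fun p => p.1.insertIdx p.2 (n + 1)) ?_ ?_ ?_ ?_ ?_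
  · intro l hl
    obtain ⟨h1, h2, h3⟩ := key l hl
    rw [Finset.mem_sigma]
    rw [← h3] at hl
    exact (insertIdx_mem_avoiders h2 h1).1 hl
  · rintro ⟨l, i⟩ hp
    rw [Finset.mem_sigma] at hp
    exact (insertIdx_mem_avoiders (mem_avoiders.1 hp.1).1 (mem_activeSites.1 hp.2).1).2 hp
  · intro l hl
    exact (key l hl).2.2
  · rintro ⟨l, i⟩ hp
    rw [Finset.mem_sigma] at hp
    obtain ⟨hl, hi⟩ := hp
    have hl' := (mem_avoiders.1 hl).1
    have hlen : l.length = n := length_of_perm hl'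
    have hi' : i ≤ n := (mem_activeSites.1 hi).1
    have hnot : n + 1 ∉ l := fun hm => by
      have := hl'.mem_iff.1 hm
      simp [incrPerm] at this
    have hd : (l.insertIdx i (n + 1)).Nodup :=
      (List.perm_insertIdx _ _ (by omega)).nodup_iff.2 (List.nodup_cons.2 ⟨hnot, nodup_of_perm hl'⟩)
    have hidx : (l.insertIdx i (n + 1)).idxOf (n + 1) = i := by
      have hlt : i < (l.insertIdx i (n + 1)).length := by
        rw [List.length_insertIdx_of_le_length (by omega)]
        omega
      have := hd.idxOf_getElem i hlt
      rwa [List.getElem_insertIdx_self] at this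
    simp only [hidx, List.eraseIdx_insertIdx_self]
  · intro l hl
    rw [(key l hl).2.2]

end permutations

section moments

open Finset

/-- The sum of a function of the numbers of sites of the three kinds over the avoiders of
length `n`. -/
noncomputable def moment (g : ℕ → ℕ → ℕ → ℤ) (n : ℕ) : ℤ :=
  ∑ l ∈ avoiders n, siteEval g (toSeq l) n

theorem moment_congr {g h : ℕ → ℕ → ℕ → ℤ} (hgh : ∀ m q s, (s = 0 → q = 0) → g m q s = h m q s)
    (n : ℕ) : moment g n = moment h n := by
  refine sum_congr rfl fun l _ => hgh _ _ _ fun h0 => ?_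
  rw [card_eq_zero] at h0 ⊢
  exact skewSites_eq_empty h0

theorem moment_add (g h : ℕ → ℕ → ℕ → ℤ) (n : ℕ) :
    moment (fun m q s => g m q s + h m q s) n = moment g n + moment h n :=
  sum_add_distrib

theorem moment_mul (c : ℤ) (g : ℕ → ℕ → ℕ → ℤ) (n : ℕ) :
    moment (fun m q s => c * g m q s) n = c * moment g n :=
  (mul_sum _ _ _).symm

theorem moment_succ (g : ℕ → ℕ → ℕ → ℤ) (n : ℕ) :
    moment g (n + 1) = moment (fun m q s => g m 0 (s + 1) +
      ∑ t ∈ range s, g (m + t + 1) ((if t = 0 then q else 0) + 1) 1 +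
      q * g 1 1 1 + (m - q) * g 1 0 0) n := by
  rw [moment, sum_avoiders_succ]
  refine sum_congr rfl fun l hl => ?_
  have hp := (mem_avoiders.1 hl).1
  rw [← sum_siteEval_insertAt g (toSeq_lt_of_perm hp) (toSeq_ne_of_perm hp)]
  refine sum_congr rfl fun i hi => ?_
  rw [toSeq_insertIdx]
  rw [length_of_perm hp]
  exact (mem_activeSites.1 hi).1

theorem sum_range_two_mul_add (m : ℤ) (s : ℕ) :
    2 * ∑ t ∈ range s, (m + t + 1) = 2 * (m * s) + s * s + s := by
  induction s with
  | zero => simp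
  | succ s ih =>
    rw [sum_range_succ, mul_add, ih]
    push_cast
    ring

theorem sum_range_ite_zero {q s : ℕ} (h : s = 0 → q = 0) :
    ∑ t ∈ range s, (if t = 0 then (q : ℤ) else 0) = q := by
  rcases s with _ | s
  · simp [h rfl]
  · simp

theorem moment_one_succ (n : ℕ) :
    moment (fun _ _ _ => 1) (n + 1) =
      moment (fun m _ _ => m) n + moment (fun _ _ s => s) n + moment (fun _ _ _ => 1) n := by
  rw [moment_succ, ← moment_add, ← moment_add]
  refine moment_congr (fun m q s _ => ?_) n
  simp
  ring

theorem moment_desc_succ (n : ℕ) :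
    2 * moment (fun m _ _ => m) (n + 1) =
      4 * moment (fun m _ _ => m) n + moment (fun m _ s => 2 * (m * s) + s * s + s) n := by
  rw [moment_succ, ← moment_mul, ← moment_mul, ← moment_add]
  refine moment_congr (fun m q s _ => ?_) n
  have := sum_range_two_mul_add m s
  push_cast
  linear_combination this

theorem moment_skew_succ (n : ℕ) :
    moment (fun _ q _ => q) (n + 1) =
      moment (fun _ _ s => s) n + 2 * moment (fun _ q _ => q) n := by
  rw [moment_succ, ← moment_mul, ← moment_add]
  refine moment_congr (fun m q s h => ?_) n
  have := sum_range_ite_zero h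
  push_cast
  rw [sum_add_distrib, this]
  simp
  ring

theorem moment_inc_succ (n : ℕ) :
    moment (fun _ _ s => s) (n + 1) =
      2 * moment (fun _ _ s => s) n + moment (fun _ q _ => q) n +
        moment (fun _ _ _ => 1) n := by
  rw [moment_succ, ← moment_mul, ← moment_add, ← moment_add]
  refine moment_congr (fun m q s _ => ?_) n
  simp
  ring

theorem moment_mixed_succ (n : ℕ) :
    moment (fun m _ s => 2 * (m * s) + s * s + s) (n + 1) =
      2 * moment (fun m _ s => 2 * (m * s) + s * s + s) n + 2 * moment (fun m _ _ => m) n +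
        4 * moment (fun _ _ s => s) n + 2 * moment (fun _ _ _ => 1) n +
        4 * moment (fun _ q _ => q) n := by
  rw [moment_succ, ← moment_mul, ← moment_mul, ← moment_mul, ← moment_mul, ← moment_mul,
    ← moment_add, ← moment_add, ← moment_add, ← moment_add]
  refine moment_congr (fun m q s _ => ?_) n
  have := sum_range_two_mul_add m s
  push_cast
  simp only [mul_one, mul_zero, sum_add_distrib, ← mul_sum, add_zero, sum_const, card_range,
    nsmul_eq_mul] at this ⊢
  linear_combination this

theorem avoiders_zero : avoiders 0 = {[]} := by
  ext l
  rw [mem_avoiders, mem_singleton]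
  constructor
  · exact fun h => List.perm_nil.1 h.1
  · rintro rfl
    exact ⟨List.Perm.refl _, by intros _ _ _ _; omega, by intros _ _ _ _; omega⟩

theorem moment_zero (g : ℕ → ℕ → ℕ → ℤ) : moment g 0 = g 0 0 0 := by
  have h1 : descSites (toSeq []) 0 = ∅ := by
    ext k
    simp only [mem_descSites, notMem_empty, iff_false]
    exact fun h => h.2 (incOn_of_le (by omega))
  have h3 : incSites (toSeq []) 0 = ∅ := by
    ext k
    simp only [mem_incSites, notMem_empty, iff_false]
    exact fun h => Nat.not_lt_zero _ h.1
  rw [moment, avoiders_zero, sum_singleton, siteEval, h1, h3, skewSites_eq_empty h3]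
  rfl

theorem card_avoiders (n : ℕ) : ((avoiders n).card : ℤ) = moment (fun _ _ _ => 1) n := by
  simp [moment, siteEval]

theorem moment_one_recurrence (n : ℕ) :
    moment (fun _ _ _ => 1) (n + 4) = 8 * moment (fun _ _ _ => 1) (n + 3) -
      21 * moment (fun _ _ _ => 1) (n + 2) + 20 * moment (fun _ _ _ => 1) (n + 1) -
      4 * moment (fun _ _ _ => 1) n := by
  have a0 := moment_one_succ n
  have a1 := moment_one_succ (n + 1)
  have a2 := moment_one_succ (n + 2)
  have a3 := moment_one_succ (n + 3)
  have m0 := moment_desc_succ n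
  have m1 := moment_desc_succ (n + 1)
  have m2 := moment_desc_succ (n + 2)
  have q0 := moment_skew_succ n
  have q1 := moment_skew_succ (n + 1)
  have q2 := moment_skew_succ (n + 2)
  have s0 := moment_inc_succ n
  have s1 := moment_inc_succ (n + 1)
  have s2 := moment_inc_succ (n + 2)
  have u0 := moment_mixed_succ n
  have u1 := moment_mixed_succ (n + 1)
  have u2 := moment_mixed_succ (n + 2)
  simp only [add_assoc, Nat.reduceAdd] at *
  omega

theorem setOf_eq_avoiders (n : ℕ) :
    {l : List ℕ | IsPermList l ∧ l.length = n ∧ PAvoids l [4, 3, 2, 1] ∧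
      PAvoids l [3, 1, 4, 2]} = avoiders n := by
  ext l
  rw [Set.mem_ofPred_eq, mem_coe, mem_avoiders, pAvoids_iff_avoidsBoth]
  constructor
  · rintro ⟨h, rfl, h'⟩
    exact ⟨h, h'⟩
  · rintro ⟨h, h'⟩
    obtain rfl := length_of_perm h
    exact ⟨h, rfl, h'⟩

end moments

/-- the generating function `A(x)` for `Av(4321, 3142)` satisfies
`(1 - 8x + 21x^2 - 20x^3 + 4x^4) * A(x) = 1 - 7x + 15x^2 - 9x^3`; equivalently,
`A(x) = (1-x)(1-3x)^2 / ((1-2x)^2 (1-4x+x^2))`. -/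
theorem stmt11 (a : ℕ → ℕ)
    (ha : ∀ n, a n = Set.ncard {l : List ℕ |
      IsPermList l ∧ l.length = n ∧ PAvoids l [4,3,2,1] ∧ PAvoids l [3,1,4,2]}) :
    (1 - 8 * PowerSeries.X + 21 * PowerSeries.X ^ 2 - 20 * PowerSeries.X ^ 3
        + 4 * PowerSeries.X ^ 4 : PowerSeries ℤ) * PowerSeries.mk (fun n => (a n : ℤ)) =
      1 - 7 * PowerSeries.X + 15 * PowerSeries.X ^ 2 - 9 * PowerSeries.X ^ 3 := by
  have hA : ∀ n, (a n : ℤ) = moment (fun _ _ _ => 1) n := fun n => by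
    rw [ha, setOf_eq_avoiders, Set.ncard_coe_finset, card_avoiders]
  have h0 : (a 0 : ℤ) = 1 := by rw [hA, moment_zero]
  have h1 : (a 1 : ℤ) = 1 := by
    rw [hA, moment_one_succ]
    simp [moment_zero]
  have h2 : (a 2 : ℤ) = 2 := by
    rw [hA, moment_one_succ, moment_one_succ, moment_inc_succ]
    have := moment_desc_succ 0
    simp [moment_zero] at this ⊢
    omega
  have h3 : (a 3 : ℤ) = 6 := by
    have a0 := moment_one_succ 0
    have a1 := moment_one_succ 1
    have a2 := moment_one_succ 2
    have m0 := moment_desc_succ 0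
    have m1 := moment_desc_succ 1
    have q0 := moment_skew_succ 0
    have s0 := moment_inc_succ 0
    have s1 := moment_inc_succ 1
    have u0 := moment_mixed_succ 0
    rw [hA]
    simp only [moment_zero, zero_add, Nat.reduceAdd, Nat.cast_zero] at *
    omega
  have hrec : ∀ n, (a (n + 4) : ℤ) =
      8 * a (n + 3) - 21 * a (n + 2) + 20 * a (n + 1) - 4 * a n := fun n => by
    simp only [hA]
    exact moment_one_recurrence n
  have hmul : ∀ (k : ℤ) (m n : ℕ), PowerSeries.coeff n (PowerSeries.C k * (PowerSeries.X ^ m *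
      PowerSeries.mk fun n => (a n : ℤ))) = k * if m ≤ n then (a (n - m) : ℤ) else 0 := by
    intro k m n
    rw [PowerSeries.coeff_C_mul, PowerSeries.coeff_X_pow_mul']
    simp
  have hX : ∀ (k : ℤ) (m n : ℕ), PowerSeries.coeff n (PowerSeries.C k * PowerSeries.X ^ m) =
      k * if n = m then 1 else 0 := by
    intro k m n
    rw [PowerSeries.coeff_C_mul, PowerSeries.coeff_X_pow]
  have hl : (1 - 8 * PowerSeries.X + 21 * PowerSeries.X ^ 2 - 20 * PowerSeries.X ^ 3
        + 4 * PowerSeries.X ^ 4 : PowerSeries ℤ) * PowerSeries.mk (fun n => (a n : ℤ)) =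
      PowerSeries.mk (fun n => (a n : ℤ)) -
        PowerSeries.C 8 * (PowerSeries.X ^ 1 * PowerSeries.mk fun n => (a n : ℤ)) +
        PowerSeries.C 21 * (PowerSeries.X ^ 2 * PowerSeries.mk fun n => (a n : ℤ)) -
        PowerSeries.C 20 * (PowerSeries.X ^ 3 * PowerSeries.mk fun n => (a n : ℤ)) +
        PowerSeries.C 4 * (PowerSeries.X ^ 4 * PowerSeries.mk fun n => (a n : ℤ)) := by
    simp only [map_ofNat]
    ring
  have hr : (1 - 7 * PowerSeries.X + 15 * PowerSeries.X ^ 2 - 9 * PowerSeries.X ^ 3 :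
      PowerSeries ℤ) = 1 - PowerSeries.C 7 * PowerSeries.X ^ 1 +
        PowerSeries.C 15 * PowerSeries.X ^ 2 - PowerSeries.C 9 * PowerSeries.X ^ 3 := by
    simp only [map_ofNat]
    ring
  rw [hl, hr]
  ext n
  simp only [map_add, map_sub, hmul, hX, PowerSeries.coeff_mk, PowerSeries.coeff_one]
  rcases n with _ | _ | _ | _ | n
  · simp [h0]
  · simp [h0, h1]
  · simp [h0, h1, h2]
  · simp [h0, h1, h2, h3]
  · simp [hrec, show n + 4 - 3 = n + 1 by omega, show n + 4 - 2 = n + 2 by omega]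
    ring
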